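/- Let n ≥ 2 and let Q₁, …, Qₙ be n affinely independent points in ℝⁿ, so that F = conv{Q₁, …, Qₙ} is an (n−1)-simplex in ℝⁿ (a side of an n-simplex) with positive (n−1)-dimensional Hausdorff measure |F| := H^{n−1}(F). Then every affine function f : ℝⁿ → ℝ and every vertex P ∈ {Q₁, …, Qₙ} satisfy f(P)² ≤ (n²/|F|) · ∫_F f² dH^{n−1}. -/

import Mathlib

open MeasureTheory

section Helpers

set_option linter.unusedSectionVars false

variable {ι V : Type*} [Fintype ι] [DecidableEq ι] [NormedAddCommGroup V] [NormedSpace ℝ V]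
  [FiniteDimensional ℝ V] [MeasurableSpace V] [BorelSpace V]

lemma coord_shift (b : AffineBasis ι ℝ V) (i j k : ι) (x : V) (t : ℝ) :
    b.coord k (x + t • (b i - b j)) =
      b.coord k x + t * (b.coord k (b i) - b.coord k (b j)) := by
  have h1 : x + t • (b i - b j) = (t • (b i - b j)) +ᵥ x := by simp [add_comm]
  have h2 : (b.coord k).linear (b i - b j) = b.coord k (b i) - b.coord k (b j) := by
    have := (b.coord k).linearMap_vsub (b i) (b j)
    simpa using this
  rw [h1, AffineMap.map_vadd, map_smul, h2]
  simp [add_comm]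

lemma coord_cont (b : AffineBasis ι ℝ V) (k : ι) : Continuous (b.coord k) :=
  (b.coord k).continuous_of_finiteDimensional

/-- the shear sending the vertex `b j` to the midpoint of `b i` and `b j` -/
noncomputable def shear (b : AffineBasis ι ℝ V) (i j : ι) (x : V) : V :=
  x + (b.coord j x / 2) • (b i - b j)

lemma coord_shear (b : AffineBasis ι ℝ V) (i j k : ι) (x : V) :
    b.coord k (shear b i j x) =
      b.coord k x + (b.coord j x / 2) *
        ((if k = i then 1 else 0) - (if k = j then 1 else 0)) := by
  rw [shear, coord_shift, b.coord_apply, b.coord_apply]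

lemma half_integral (b : AffineBasis ι ℝ V) (μ : Measure V) [μ.IsAddHaarMeasure] {i j : ι}
    (hij : i ≠ j) (g : V → ℝ) :
    ∫ x in {x | (∀ k, 0 ≤ b.coord k x) ∧ b.coord j x ≤ b.coord i x}, g x ∂μ =
      (1 / 2) * ∫ x in {x | ∀ k, 0 ≤ b.coord k x}, g (shear b i j x) ∂μ := by
  have himg : {x | (∀ k, 0 ≤ b.coord k x) ∧ b.coord j x ≤ b.coord i x} =
      shear b i j '' {x | ∀ k, 0 ≤ b.coord k x} := by
    ext x
    constructor
    · rintro ⟨hx, hx'⟩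
      refine ⟨x + b.coord j x • (b j - b i), ?_, ?_⟩
      · intro k
        rw [coord_shift, b.coord_apply, b.coord_apply]
        have := hx k
        have := hx j
        by_cases h1 : k = i
        · subst h1; simp [hij]; linarith
        · by_cases h2 : k = j
          · subst h2; simp [h1]; linarith
          · simp [h1, h2]; linarith
      · have : b.coord j (x + b.coord j x • (b j - b i)) = 2 * b.coord j x := by
          rw [coord_shift, b.coord_apply, b.coord_apply]
          simp [hij.symm]; ring
        rw [shear, this]
        module
    · rintro ⟨y, hy, rfl⟩
      have hyj := hy j
      have hyi := hy i
      refine ⟨fun k => ?_, ?_⟩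
      · rw [coord_shear]
        have := hy k
        by_cases h1 : k = i
        · subst h1; simp [hij]; linarith
        · by_cases h2 : k = j
          · subst h2; simp [h1]; linarith
          · simp [h1, h2]; linarith
      · rw [coord_shear, coord_shear]
        simp [hij, hij.symm]; linarith
  have hinj : Function.Injective (shear b i j) := by
    intro x y hxy
    have h := congrArg (b.coord j) hxy
    rw [coord_shear, coord_shear] at h
    simp [hij.symm] at h
    have h' : b.coord j x = b.coord j y := by linarith
    simpa [shear, h'] using hxy
  have hmeas : MeasurableSet {x | ∀ k, 0 ≤ b.coord k x} := by
    have : {x | ∀ k, 0 ≤ b.coord k x} = ⋂ k, {x | 0 ≤ b.coord k x} := by ext; simp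
    rw [this]
    exact MeasurableSet.iInter fun k =>
      (isClosed_le continuous_const (coord_cont b k)).measurableSet
  let L : V →ₗ[ℝ] V := LinearMap.transvection ((1 / 2 : ℝ) • (b.coord j).linear) (b i - b j)
  have hdet : L.det = 1 / 2 := by
    have h2 : (b.coord j).linear (b i - b j) = b.coord j (b i) - b.coord j (b j) := by
      have := (b.coord j).linearMap_vsub (b i) (b j)
      simpa using this
    simp only [L]
    rw [LinearMap.transvection.det, LinearMap.smul_apply, h2, b.coord_apply, b.coord_apply]
    simp only [hij.symm, if_true, if_false, smul_eq_mul]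
    norm_num
  have hder : ∀ x ∈ {x | ∀ k, 0 ≤ b.coord k x},
      HasFDerivWithinAt (shear b i j) (LinearMap.toContinuousLinearMap L)
        {x | ∀ k, 0 ≤ b.coord k x} x := by
    intro x _
    have hs : shear b i j = fun x => LinearMap.toContinuousLinearMap L x + shear b i j 0 := by
      funext x
      have hx : b.coord j x = (b.coord j).linear x + b.coord j 0 := by
        have := (b.coord j).map_vadd 0 x
        simpa using this
      simp only [shear, L, LinearMap.coe_toContinuousLinearMap', LinearMap.transvection.apply, hx]
      simp only [LinearMap.smul_apply, smul_eq_mul]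
      module
    rw [hs]
    exact ((LinearMap.toContinuousLinearMap L).hasFDerivAt.add_const _).hasFDerivWithinAt
  rw [himg, integral_image_eq_integral_abs_det_fderiv_smul μ hmeas hder hinj.injOn]
  have : (LinearMap.toContinuousLinearMap L).det = 1 / 2 := by
    rw [← hdet]; simp
  simp only [this, smul_eq_mul]
  rw [integral_const_mul]
  norm_num

lemma isCompact_simplex (b : AffineBasis ι ℝ V) : IsCompact {x | ∀ k, 0 ≤ b.coord k x} := by
  rw [← b.convexHull_eq_nonneg_coord]
  exact (Set.finite_range b).isCompact_convexHull ℝ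

lemma subdivide (b : AffineBasis ι ℝ V) (μ : Measure V) [μ.IsAddHaarMeasure] {i j : ι}
    (hij : i ≠ j) (g : V → ℝ) (hg : Continuous g) :
    ∫ x in {x | ∀ k, 0 ≤ b.coord k x}, g x ∂μ =
      (1 / 2) * ((∫ x in {x | ∀ k, 0 ≤ b.coord k x}, g (shear b i j x) ∂μ) +
        ∫ x in {x | ∀ k, 0 ≤ b.coord k x}, g (shear b j i x) ∂μ) := by
  rw [mul_add, ← half_integral b μ hij, ← half_integral b μ hij.symm]
  have hS := isCompact_simplex b
  have hun : {x | ∀ k, 0 ≤ b.coord k x} =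
      {x | (∀ k, 0 ≤ b.coord k x) ∧ b.coord j x ≤ b.coord i x} ∪
      {x | (∀ k, 0 ≤ b.coord k x) ∧ b.coord i x ≤ b.coord j x} := by
    ext x
    have := le_total (b.coord j x) (b.coord i x)
    simp only [Set.mem_union, Set.mem_ofPred_eq]
    tauto
  have hint := hg.continuousOn.integrableOn_compact (μ := μ) hS
  conv_lhs => rw [hun]
  refine setIntegral_union₀ ?_ ?_ ?_ ?_
  · let h : V →ᵃ[ℝ] ℝ := b.coord i - b.coord j
    let s : AffineSubspace ℝ V := (affineSpan ℝ {(0 : ℝ)}).comap h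
    have hs : s ≠ ⊤ := by
      intro hs
      have : b i ∈ s := by rw [hs]; trivial
      simp [s, h, b.coord_apply, hij.symm, AffineSubspace.mem_affineSpan_singleton] at this
    refine measure_mono_null ?_ (Measure.addHaar_affineSubspace μ s hs)
    rintro x ⟨hx1, hx2⟩
    have : b.coord i x = b.coord j x := le_antisymm hx2.2 hx1.2
    simp [s, h, this, AffineSubspace.mem_affineSpan_singleton]
  · exact (hS.measurableSet.inter
      (isClosed_le (coord_cont b i) (coord_cont b j)).measurableSet).nullMeasurableSet
  · exact hint.mono_set fun x hx => hx.1
  · exact hint.mono_set fun x hx => hx.1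

lemma moments (b : AffineBasis ι ℝ V) (μ : Measure V) [μ.IsAddHaarMeasure] {i j : ι}
    (hij : i ≠ j) :
    (∫ x in {x | ∀ k, 0 ≤ b.coord k x}, b.coord i x * b.coord i x ∂μ) =
      2 * ∫ x in {x | ∀ k, 0 ≤ b.coord k x}, b.coord i x * b.coord j x ∂μ := by
  have hS := isCompact_simplex b
  have hint : ∀ k l, IntegrableOn (fun x => b.coord k x * b.coord l x)
      {x | ∀ k, 0 ≤ b.coord k x} μ := fun k l =>
    ((coord_cont b k).mul (coord_cont b l)).continuousOn.integrableOn_compact hS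
  have e1 := subdivide b μ hij (fun x => b.coord i x * b.coord j x)
    ((coord_cont b i).mul (coord_cont b j))
  have e2 := subdivide b μ hij (fun x => b.coord i x * b.coord i x)
    ((coord_cont b i).mul (coord_cont b i))
  simp only [coord_shear, hij, hij.symm, if_true, if_false] at e1 e2
  have f1 : ∀ x, (b.coord i x + b.coord j x / 2 * (1 - 0)) * (b.coord j x + b.coord j x / 2 * (0 - 1))
      = (1/2) * (b.coord i x * b.coord j x) + (1/4) * (b.coord j x * b.coord j x) := by
    intro x; ring
  have f2 : ∀ x, (b.coord i x + b.coord i x / 2 * (0 - 1)) * (b.coord j x + b.coord i x / 2 * (1 - 0))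
      = (1/2) * (b.coord i x * b.coord j x) + (1/4) * (b.coord i x * b.coord i x) := by
    intro x; ring
  have f3 : ∀ x, (b.coord i x + b.coord j x / 2 * (1 - 0)) * (b.coord i x + b.coord j x / 2 * (1 - 0))
      = (b.coord i x * b.coord i x + b.coord i x * b.coord j x)
        + (1/4) * (b.coord j x * b.coord j x) := by
    intro x; ring
  have f4 : ∀ x, (b.coord i x + b.coord i x / 2 * (0 - 1)) * (b.coord i x + b.coord i x / 2 * (0 - 1))
      = (1/4) * (b.coord i x * b.coord i x) := by
    intro x; ring
  simp only [f1, f2, f3, f4] at e1 e2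
  rw [integral_add ((hint i j).const_mul _) ((hint j j).const_mul _),
    integral_add ((hint i j).const_mul _) ((hint i i).const_mul _)] at e1
  have hadd : IntegrableOn (fun x => b.coord i x * b.coord i x + b.coord i x * b.coord j x)
      {x | ∀ k, 0 ≤ b.coord k x} μ := (hint i i).add (hint i j)
  rw [integral_add hadd ((hint j j).const_mul _), integral_add (hint i i) (hint i j)] at e2
  simp only [integral_const_mul] at e1 e2
  linarith

lemma quad_ineq (c : ι → ℝ) (i : ι) :
    ((Fintype.card ι : ℝ) + 1) * c i ^ 2 ≤
      Fintype.card ι * (∑ k, c k ^ 2 + (∑ k, c k) ^ 2) := by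
  have hn : (0 : ℝ) < Fintype.card ι := by
    have : Nonempty ι := ⟨i⟩
    exact_mod_cast Fintype.card_pos
  set n : ℝ := (Fintype.card ι : ℝ) with hnn
  set s := ∑ k, c k with hs
  have h0 : 0 ≤ ∑ k, (if k = i then 0 else (c k + c i / n) ^ 2) :=
    Finset.sum_nonneg fun k _ => by split_ifs <;> positivity
  have h1 : ∑ k, (if k = i then 0 else (c k + c i / n) ^ 2) =
      ∑ k, (c k + c i / n) ^ 2 - (c i + c i / n) ^ 2 := by
    have e : (c i + c i / n) ^ 2 = ∑ k, (if k = i then (c k + c i / n) ^ 2 else 0) := by simp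
    rw [eq_sub_iff_add_eq, e]
    rw [← Finset.sum_add_distrib]
    refine Finset.sum_congr rfl fun k _ => ?_
    split_ifs <;> simp
  have h2 : ∑ k, (c k + c i / n) ^ 2 = ∑ k, c k ^ 2 + 2 * (c i / n) * s + n * (c i / n) ^ 2 := by
    simp only [add_sq, Finset.sum_add_distrib]
    rw [hs, Finset.mul_sum]
    simp [← hnn]
    refine Finset.sum_congr rfl fun k _ => ?_
    ring
  rw [h1, h2] at h0
  have h3 : c i = n * (c i / n) := by field_simp
  set t := c i / n
  rw [h3] at h0 ⊢
  have h4 := mul_nonneg hn.le h0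
  have h5 := mul_nonneg hn.le (sq_nonneg (s - t))
  nlinarith

lemma vertex_core (b : AffineBasis ι ℝ V) (μ : Measure V) [μ.IsAddHaarMeasure]
    [Nontrivial ι] (f : V →ᵃ[ℝ] ℝ) (i : ι) :
    f (b i) ^ 2 * (μ (convexHull ℝ (Set.range b))).toReal ≤
      (Fintype.card ι : ℝ) ^ 2 * ∫ x in convexHull ℝ (Set.range b), f x ^ 2 ∂μ := by
  rw [b.convexHull_eq_nonneg_coord]
  have hS := isCompact_simplex b
  have hint : ∀ k l, IntegrableOn (fun x => b.coord k x * b.coord l x)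
      {x | ∀ k, 0 ≤ b.coord k x} μ := fun k l =>
    ((coord_cont b k).mul (coord_cont b l)).continuousOn.integrableOn_compact hS
  obtain ⟨i', hi'⟩ := exists_ne i
  set J : ι → ι → ℝ := fun k l =>
    ∫ x in {x | ∀ k, 0 ≤ b.coord k x}, b.coord k x * b.coord l x ∂μ with hJ
  have hsymm : ∀ k l, J k l = J l k := fun k l => by simp only [hJ, mul_comm]
  have hmom : ∀ k l, k ≠ l → J k k = 2 * J k l := fun k l h => moments b μ h
  have hdiag : ∀ k, J k k = J i i := by
    intro k
    by_cases h : k = i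
    · rw [h]
    · rw [hmom k i h, hmom i k (Ne.symm h), hsymm]
  set β := J i i / 2 with hβ
  have hJv : ∀ k l, J k l = β * (1 + if k = l then 1 else 0) := by
    intro k l
    split_ifs with h
    · subst h; rw [hdiag, hβ]; ring
    · have := hmom k l h
      rw [hdiag] at this
      rw [hβ]; linarith
  have hβ0 : 0 ≤ β := by
    have : 0 ≤ J i i := integral_nonneg fun x => mul_self_nonneg _
    linarith
  have hsum : ∀ c d : ι → ℝ, ∫ x in {x | ∀ k, 0 ≤ b.coord k x},
      (∑ k, c k * b.coord k x) * (∑ k, d k * b.coord k x) ∂μ =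
      β * ((∑ k, c k * d k) + (∑ k, c k) * ∑ k, d k) := by
    intro c d
    have : ∀ x, (∑ k, c k * b.coord k x) * (∑ k, d k * b.coord k x) =
        ∑ k, ∑ l, (c k * d l) * (b.coord k x * b.coord l x) := by
      intro x
      rw [Finset.sum_mul_sum]
      refine Finset.sum_congr rfl fun k _ => Finset.sum_congr rfl fun l _ => ?_
      ring
    simp only [this]
    rw [integral_finsetSum _ fun k _ => integrable_finsetSum _ fun l _ => (hint k l).const_mul _]
    simp_rw [integral_finsetSum _ fun l _ => (hint _ l).const_mul _, integral_const_mul]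
    change ∑ k, ∑ l, c k * d l * J k l = _
    simp only [hJv, mul_add, mul_ite, mul_one, mul_zero, Finset.sum_add_distrib,
      Finset.sum_ite_eq, Finset.mem_univ, if_true]
    rw [Finset.sum_mul_sum, Finset.mul_sum, Finset.mul_sum, add_comm]
    congr 1
    · refine Finset.sum_congr rfl fun k _ => by ring
    · refine Finset.sum_congr rfl fun k _ => ?_
      rw [Finset.mul_sum]
      refine Finset.sum_congr rfl fun l _ => by ring
  have hvol := hsum (fun _ => 1) (fun _ => 1)
  simp only [one_mul, b.sum_coord_apply_eq_one] at hvol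
  simp [Measure.real] at hvol
  have hf : ∀ x, f x = ∑ k, f (b k) * b.coord k x := by
    intro x
    have h := b.affineCombination_coord_eq_self x
    have h2 := Finset.univ.map_affineCombination (⇑b) (fun k => b.coord k x)
      (b.sum_coord_apply_eq_one x) f
    rw [h, Finset.affineCombination_eq_linear_combination _ _ _ (b.sum_coord_apply_eq_one x)] at h2
    rw [h2]
    refine Finset.sum_congr rfl fun k _ => ?_
    simp [mul_comm]
  have hff := hsum (fun k => f (b k)) (fun k => f (b k))
  simp only [← hf] at hff
  have hff' : ∫ x in {x | ∀ k, 0 ≤ b.coord k x}, f x ^ 2 ∂μ =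
      β * (∑ k, f (b k) ^ 2 + (∑ k, f (b k)) ^ 2) := by
    simp only [sq]; exact hff
  rw [hff', hvol]
  have hq := quad_ineq (fun k => f (b k)) i
  have := mul_le_mul_of_nonneg_left hq (mul_nonneg hβ0 (Nat.cast_nonneg (α := ℝ) (Fintype.card ι)))
  nlinarith

end Helpers

/-- Appendix D, Corollary: for an `(n-1)`-simplex `F = conv{Q₁, …, Qₙ} ⊂ ℝⁿ` of
positive surface measure `|F|`, any affine `f` and any vertex `Q i`,
`f(Q i)² ≤ (n²/|F|) ∫_F f² dH^{n-1}`. -/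
theorem vertex_value_sq_le_side (n : ℕ) (hn : 2 ≤ n)
    (Q : Fin n → EuclideanSpace ℝ (Fin n)) (hQ : AffineIndependent ℝ Q)
    (hF : 0 < (μH[(n : ℝ) - 1] (convexHull ℝ (Set.range Q))).toReal)
    (f : EuclideanSpace ℝ (Fin n) →ᵃ[ℝ] ℝ) (i : Fin n) :
    (f (Q i)) ^ 2 ≤
      (n : ℝ) ^ 2 / (μH[(n : ℝ) - 1] (convexHull ℝ (Set.range Q))).toReal *
        ∫ y in convexHull ℝ (Set.range Q), (f y) ^ 2 ∂(μH[(n : ℝ) - 1]) := by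
  let W : Submodule ℝ (EuclideanSpace ℝ (Fin n)) := vectorSpan ℝ (Set.range Q)
  have hfin : Module.finrank ℝ W = n - 1 :=
    hQ.finrank_vectorSpan (by rw [Fintype.card_fin]; omega)
  have hd : ((Module.finrank ℝ W : ℕ) : ℝ) = (n : ℝ) - 1 := by
    rw [hfin, Nat.cast_sub (by omega)]; simp
  let φ : W →ᵃ[ℝ] EuclideanSpace ℝ (Fin n) :=
    W.subtype.toAffineMap + AffineMap.const ℝ W (Q i)
  have hφ : ∀ w : W, φ w = (w : EuclideanSpace ℝ (Fin n)) + Q i := fun w => by simp [φ]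
  have hiso : Isometry φ := by
    refine Isometry.of_dist_eq fun x y => ?_
    rw [hφ, hφ, dist_add_right]
    rfl
  let p : Fin n → W := fun k =>
    ⟨Q k - Q i, vsub_mem_vectorSpan ℝ (Set.mem_range_self k) (Set.mem_range_self i)⟩
  have hφp : φ ∘ p = Q := by
    funext k
    simp [hφ, p]
  have hp : AffineIndependent ℝ p := AffineIndependent.of_comp φ (by rw [hφp]; exact hQ)
  have htop : affineSpan ℝ (Set.range p) = ⊤ := by
    rw [hp.affineSpan_eq_top_iff_card_eq_finrank_add_one, hfin, Fintype.card_fin]; omega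
  let b : AffineBasis (Fin n) ℝ W := ⟨p, hp, htop⟩
  have hb : ⇑b = p := rfl
  have himg : φ '' convexHull ℝ (Set.range p) = convexHull ℝ (Set.range Q) := by
    rw [φ.image_convexHull, ← Set.range_comp, hφp]
  have hpre : φ ⁻¹' convexHull ℝ (Set.range Q) = convexHull ℝ (Set.range p) := by
    rw [← himg, Set.preimage_image_eq _ hiso.injective]
  have hd0 : 0 ≤ (n : ℝ) - 1 := by
    rw [← hd]; positivity
  have hmap := hiso.map_hausdorffMeasure (d := (n : ℝ) - 1) (Or.inl hd0)
  have hemb : MeasurableEmbedding φ := hiso.isClosedEmbedding.measurableEmbedding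
  have hcomp : IsCompact (convexHull ℝ (Set.range Q)) :=
    (Set.finite_range Q).isCompact_convexHull ℝ
  have hint : ∫ y in convexHull ℝ (Set.range Q), (f y) ^ 2 ∂(μH[(n : ℝ) - 1]) =
      ∫ x in convexHull ℝ (Set.range p), (f (φ x)) ^ 2 ∂(μH[(n : ℝ) - 1]) := by
    have := hemb.setIntegral_map (μ := μH[(n : ℝ) - 1]) (fun y => (f y) ^ 2)
      (convexHull ℝ (Set.range Q))
    rw [hpre, hmap, Measure.restrict_restrict hcomp.measurableSet,
      Set.inter_eq_left.2 (by rw [← himg]; exact Set.image_subset_range _ _)] at this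
    exact this
  have hvol : μH[(n : ℝ) - 1] (convexHull ℝ (Set.range Q)) =
      μH[(n : ℝ) - 1] (convexHull ℝ (Set.range p)) := by
    rw [← himg, hiso.hausdorffMeasure_image (Or.inl hd0)]
  have hHaar : (μH[(n : ℝ) - 1] : Measure W).IsAddHaarMeasure := by
    rw [← hd]; infer_instance
  have : Nontrivial (Fin n) := Fin.nontrivial_iff_two_le.2 hn
  have key := vertex_core b μH[(n : ℝ) - 1] (f.comp φ) i
  have hQi : φ (p i) = Q i := congrFun hφp i
  simp only [hb, AffineMap.comp_apply, hQi, Fintype.card_fin, ← hint, ← hvol] at key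
  rw [div_mul_eq_mul_div, le_div_iff₀ hF]
  exact key
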